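/- Let μ be a probability measure on ℝ with bounded density ρ, and let (ω_j)_{j∈Λ} be i.i.d. with distribution μ, Λ ⊂ ℤ^d finite. Let H_ω = -Δ^{(Λ)} + V_ω on ℓ²(Λ) with V_ω δ_j = ω_j δ_j. Then for every bounded interval I, E[tr χ_I(H_ω)] ≤ ‖ρ‖_∞ · |I| · |Λ| (Wegner estimate with constant 1). -/

import Mathlib

open ContinuousLinearMap MeasureTheory

/-- Real part of the trace of an operator on a finite-dimensional Hilbert space. -/
noncomputable def opTr {ι : Type*} [Fintype ι]
    (A : EuclideanSpace ℂ ι →L[ℂ] EuclideanSpace ℂ ι) : ℝ :=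
  RCLike.re (LinearMap.trace ℂ (EuclideanSpace ℂ ι) A.toLinearMap)

/-- Hilbert–Schmidt norm. -/
noncomputable def hsNorm {ι : Type*} [Fintype ι]
    (A : EuclideanSpace ℂ ι →L[ℂ] EuclideanSpace ℂ ι) : ℝ :=
  Real.sqrt (opTr (ContinuousLinearMap.adjoint A * A))

/-- Rank-one orthogonal projection `|δ⟩⟨δ|` onto a unit vector `δ`. -/
noncomputable def rankOne {ι : Type*} [Fintype ι]
    (δ : EuclideanSpace ℂ ι) : EuclideanSpace ℂ ι →L[ℂ] EuclideanSpace ℂ ι :=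
  (innerSL ℂ δ).smulRight δ

/-- Sites of the box of side `L+1` in dimension `d`, with periodic identification. -/
abbrev Sites (d L : ℕ) := Fin d → ZMod (L + 1)

/-- Unit vector in direction `i` of the lattice. -/
def latticeE (d L : ℕ) (i : Fin d) : Sites d L := fun j => if j = i then 1 else 0

/-- The matrix of the (negative) discrete Laplacian `-Δ` on the box with periodic
boundary conditions: `(-Δψ)(x) = 2d ψ(x) - Σᵢ (ψ(x+eᵢ) + ψ(x-eᵢ))`. -/
noncomputable def negLap (d L : ℕ) : Matrix (Sites d L) (Sites d L) ℂ := fun x y =>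
  (if x = y then (2 * (d : ℂ)) else 0) -
    ∑ i : Fin d,
      ((if y = x + latticeE d L i then (1 : ℂ) else 0) +
       (if y = x - latticeE d L i then (1 : ℂ) else 0))

/-- The finite-volume Anderson Hamiltonian `H_ω = -Δ + V_ω` on `ℓ²(Λ)` with periodic
boundary conditions, `V_ω δ_j = ω_j δ_j`. -/
noncomputable def finH (d L : ℕ) (ω : Sites d L → ℝ) :
    EuclideanSpace ℂ (Sites d L) →L[ℂ] EuclideanSpace ℂ (Sites d L) :=
  Matrix.toEuclideanCLM (𝕜 := ℂ)
    (negLap d L + Matrix.diagonal (fun x => (ω x : ℂ)))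


namespace Wegner
open Matrix Unitary

variable {ι : Type*} [Fintype ι] [DecidableEq ι]

noncomputable def res (M : Matrix ι ι ℂ) (z : ℂ) : Matrix ι ι ℂ := (M - z • (1 : Matrix ι ι ℂ))⁻¹

lemma sub_ne (l : ℝ) {z : ℂ} (hz : 0 < z.im) : (l : ℂ) - z ≠ 0 := by
  intro h
  have := congrArg Complex.im h
  simp at this
  linarith

lemma inv_im (l : ℝ) (z : ℂ) :
    (((l : ℂ) - z)⁻¹).im = z.im / ((l - z.re) ^ 2 + z.im ^ 2) := by
  rw [Complex.inv_im]
  simp [Complex.normSq_apply]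
  congr 1; ring

lemma shift_eq {M : Matrix ι ι ℂ} (hM : M.IsHermitian) (z : ℂ) :
    M - z • (1 : Matrix ι ι ℂ) = conjStarAlgAut ℂ _ hM.eigenvectorUnitary
      (diagonal (fun i => (hM.eigenvalues i : ℂ) - z)) := by
  have h1 : (diagonal (fun i => (hM.eigenvalues i : ℂ) - z)) =
      diagonal (RCLike.ofReal ∘ hM.eigenvalues) - z • (1 : Matrix ι ι ℂ) := by
    ext i j
    by_cases h : i = j <;> simp [h, diagonal]
  rw [h1, map_sub, map_smul, map_one, ← hM.spectral_theorem]

lemma shift_mul {M : Matrix ι ι ℂ} (hM : M.IsHermitian) {z : ℂ} (hz : 0 < z.im) :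
    (M - z • (1 : Matrix ι ι ℂ)) * conjStarAlgAut ℂ _ hM.eigenvectorUnitary
      (diagonal (fun i => ((hM.eigenvalues i : ℂ) - z)⁻¹)) = 1 := by
  rw [shift_eq hM z, ← map_mul, diagonal_mul_diagonal]
  have : (fun i => ((hM.eigenvalues i : ℂ) - z) * ((hM.eigenvalues i : ℂ) - z)⁻¹) =
     fun _ => (1 : ℂ) := by
    funext i
    exact mul_inv_cancel₀ (sub_ne _ hz)
  rw [this, diagonal_one, map_one]

lemma res_eq {M : Matrix ι ι ℂ} (hM : M.IsHermitian) {z : ℂ} (hz : 0 < z.im) :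
    res M z = conjStarAlgAut ℂ _ hM.eigenvectorUnitary
      (diagonal (fun i => ((hM.eigenvalues i : ℂ) - z)⁻¹)) :=
  Matrix.inv_eq_right_inv (shift_mul hM hz)

lemma shift_mul_res {M : Matrix ι ι ℂ} (hM : M.IsHermitian) {z : ℂ} (hz : 0 < z.im) :
    (M - z • (1 : Matrix ι ι ℂ)) * res M z = 1 := by
  rw [res_eq hM hz, shift_mul hM hz]

lemma res_mul_shift {M : Matrix ι ι ℂ} (hM : M.IsHermitian) {z : ℂ} (hz : 0 < z.im) :
    res M z * (M - z • (1 : Matrix ι ι ℂ)) = 1 :=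
  mul_eq_one_comm.mp (shift_mul_res hM hz)

lemma trace_res {M : Matrix ι ι ℂ} (hM : M.IsHermitian) {z : ℂ} (hz : 0 < z.im) :
    ∑ j, (res M z j j).im = ∑ k, z.im / ((hM.eigenvalues k - z.re) ^ 2 + z.im ^ 2) := by
  have : (res M z).trace = ∑ k, ((hM.eigenvalues k : ℂ) - z)⁻¹ := by
    rw [res_eq hM hz, conjStarAlgAut_apply, Matrix.trace_mul_comm, ← mul_assoc]
    simp [Matrix.trace]
  have h2 := congrArg Complex.im this
  simp only [Matrix.trace, Matrix.diag, Complex.im_sum] at h2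
  rw [h2]
  exact Finset.sum_congr rfl fun k _ => inv_im _ _

lemma res_im_pos {M : Matrix ι ι ℂ} (hM : M.IsHermitian) {z : ℂ} (hz : 0 < z.im) (j : ι) :
    0 < (res M z j j).im := by
  have h1 : res M z j j = ∑ k, (Complex.normSq ((hM.eigenvectorUnitary : Matrix ι ι ℂ) j k) : ℂ) *
      ((hM.eigenvalues k : ℂ) - z)⁻¹ := by
    rw [res_eq hM hz, conjStarAlgAut_apply, Matrix.mul_apply]
    refine Finset.sum_congr rfl fun k _ => ?_
    rw [Matrix.mul_diagonal, Complex.normSq_eq_conj_mul_self]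
    simp [Matrix.star_apply]
    ring
  have h2 : ∑ k, Complex.normSq ((hM.eigenvectorUnitary : Matrix ι ι ℂ) j k) = 1 := by
    have := congrFun (congrFun (Unitary.coe_mul_star_self hM.eigenvectorUnitary) j) j
    rw [Matrix.mul_apply, Matrix.one_apply_eq] at this
    have h3 : ((∑ k, Complex.normSq ((hM.eigenvectorUnitary : Matrix ι ι ℂ) j k) : ℝ) : ℂ) = 1 := by
      rw [← this]
      push_cast
      refine Finset.sum_congr rfl fun k _ => ?_
      rw [Complex.normSq_eq_conj_mul_self]
      simp [Matrix.star_apply]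
      ring
    exact_mod_cast h3
  have hpos : ∀ k, 0 < (((hM.eigenvalues k : ℂ) - z)⁻¹).im := by
    intro k
    rw [inv_im]; positivity
  rw [h1, Complex.im_sum]
  simp only [Complex.im_ofReal_mul]
  obtain ⟨k, -, hk⟩ : ∃ k ∈ Finset.univ,
      Complex.normSq ((hM.eigenvectorUnitary : Matrix ι ι ℂ) j k) ≠ 0 := by
    apply Finset.exists_ne_zero_of_sum_ne_zero
    rw [h2]; exact one_ne_zero
  refine Finset.sum_pos' (fun k _ => mul_nonneg (Complex.normSq_nonneg _) (hpos k).le)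
    ⟨k, Finset.mem_univ _, mul_pos (lt_of_le_of_ne (Complex.normSq_nonneg _) hk.symm) (hpos k)⟩

/-- rank one perturbation -/
lemma res_rank_one {M N : Matrix ι ι ℂ} (hM : M.IsHermitian) (hN : N.IsHermitian)
    {z : ℂ} (hz : 0 < z.im) (j : ι)
    (t : ℝ) (h : N = M + Matrix.single j j (t : ℂ)) :
    res N z j j * (1 + t * res M z j j) = res M z j j := by
  have e : res M z - res N z = res N z * (Matrix.single j j (t : ℂ)) * res M z := by
    have : Matrix.single j j (t : ℂ) =
      (N - z • (1 : Matrix ι ι ℂ)) - (M - z • (1 : Matrix ι ι ℂ)) := by rw [h]; abel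
    rw [this, mul_sub, sub_mul, res_mul_shift hN hz, mul_assoc, shift_mul_res hM hz]
    simp
  have e2 := congrFun (congrFun e j) j
  have e3 : (res N z * (Matrix.single j j (t : ℂ)) * res M z) j j
     = res N z j j * t * res M z j j := by
    rw [Matrix.mul_apply, Finset.sum_eq_single j]
    · simp
    · intro b _ hb
      simp [Matrix.mul_single_apply_of_ne, hb]
    · simp
  rw [e3, Matrix.sub_apply] at e2
  linear_combination -e2

lemma res_rank_one_im {M N : Matrix ι ι ℂ} (hM : M.IsHermitian) (hN : N.IsHermitian)
    {z : ℂ} (hz : 0 < z.im) (j : ι)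
    (t : ℝ) (h : N = M + Matrix.single j j (t : ℂ)) :
    (res N z j j).im = (-((res M z j j)⁻¹).im) /
      ((t - (-((res M z j j)⁻¹).re)) ^ 2 + (-((res M z j j)⁻¹).im) ^ 2) := by
  have h1 := res_rank_one hM hN hz j t h
  set g := res M z j j with hg
  have hg0 : g ≠ 0 := by
    intro h0
    have := res_im_pos hM hz j
    rw [← hg, h0] at this
    simp at this
  have hn : res N z j j = ((t : ℂ) - (- g⁻¹))⁻¹ := by
    refine eq_inv_of_mul_eq_one_left ?_
    have : (t : ℂ) - -g⁻¹ = (1 + t * g) * g⁻¹ := by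
      field_simp
      ring
    rw [this, ← mul_assoc, h1, mul_inv_cancel₀ hg0]
  rw [hn, inv_im]
  simp

lemma neg_inv_im_pos {g : ℂ} (hg : 0 < g.im) : 0 < -(g⁻¹).im := by
  rw [Complex.inv_im, neg_div, neg_neg]
  have : g ≠ 0 := by rintro rfl; simp at hg
  exact div_pos hg (Complex.normSq_pos.mpr this)

lemma lintegral_poisson (u v : ℝ) (hv : 0 < v) :
    ∫⁻ t : ℝ, ENNReal.ofReal (v / ((t - u) ^ 2 + v ^ 2)) = ENNReal.ofReal Real.pi := by
  lift v to NNReal using hv.le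
  have h := ProbabilityTheory.lintegral_cauchyPDF_eq_one u (γ := v)
    (by rintro rfl; simp at hv)
  have h2 : ∀ t : ℝ, ENNReal.ofReal (v / ((t - u) ^ 2 + v ^ 2)) =
     ENNReal.ofReal Real.pi * ProbabilityTheory.cauchyPDF u v t := by
    intro t
    rw [ProbabilityTheory.cauchyPDF_def, ProbabilityTheory.cauchyPDFReal_def,
      ← ENNReal.ofReal_mul Real.pi_pos.le]
    congr 1
    field_simp [Real.pi_pos.ne']
  simp_rw [h2]
  rw [lintegral_const_mul _ (by fun_prop), h, mul_one]

lemma opTr_cfc {M : Matrix ι ι ℂ} (hM : M.IsHermitian) (f : ℝ → ℝ) :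
    opTr (cfc f (Matrix.toEuclideanCLM (𝕜 := ℂ) M)) = ∑ k, f (hM.eigenvalues k) := by
  have hc : Continuous (Matrix.toEuclideanCLM (n := ι) (𝕜 := ℂ)) :=
    (Matrix.toEuclideanCLM (n := ι) (𝕜 := ℂ)).toAlgEquiv.toLinearMap.continuous_of_finiteDimensional
  have h1 : cfc f (Matrix.toEuclideanCLM (𝕜 := ℂ) M) = Matrix.toEuclideanCLM (𝕜 := ℂ) (cfc f M) := by
    symm
    refine StarAlgHomClass.map_cfc (S := ℂ) (Matrix.toEuclideanCLM (n := ι) (𝕜 := ℂ)) f M ?_ hc hM ?_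
    · rw [hM.spectrum_real_eq_range_eigenvalues]
      exact (Set.finite_range _).continuousOn _
    · exact IsSelfAdjoint.map (show IsSelfAdjoint M from hM) _
  rw [h1, hM.cfc_eq, opTr]
  have h2 : ∀ A : Matrix ι ι ℂ, LinearMap.trace ℂ (EuclideanSpace ℂ ι)
      (Matrix.toEuclideanCLM (𝕜 := ℂ) A).toLinearMap = A.trace := by
    intro A
    rw [Matrix.coe_toEuclideanCLM_eq_toEuclideanLin, Matrix.toEuclideanLin_eq_toLin]
    exact Matrix.trace_toLin_eq A _
  rw [h2, IsHermitian.cfc, conjStarAlgAut_apply, Matrix.trace_mul_comm, ← mul_assoc]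
  simp [Matrix.trace]

lemma lintegral_window (x η ε : ℝ) (hη : 0 < η) (hε : 0 < ε) :
    ∫⁻ E in Set.Icc (x - η) (x + η), ENNReal.ofReal (ε / ((x - E) ^ 2 + ε ^ 2))
      = ENNReal.ofReal (2 * Real.arctan (η / ε)) := by
  have hcont : Continuous fun E : ℝ => ε / ((x - E) ^ 2 + ε ^ 2) := by
    refine Continuous.div (by fun_prop) (by fun_prop) (fun E => by positivity)
  rw [← ofReal_integral_eq_lintegral_ofReal]
  · congr 1
    rw [integral_Icc_eq_integral_Ioc, ← intervalIntegral.integral_of_le (by linarith)]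
    rw [intervalIntegral.integral_eq_sub_of_hasDerivAt
      (f := fun E => Real.arctan ((E - x) / ε)) (f' := fun E : ℝ => ε / ((x - E) ^ 2 + ε ^ 2))]
    · have : (x - η - x) / ε = - (η / ε) := by ring
      rw [this, Real.arctan_neg]
      ring_nf
    · intro E _
      have h := (((hasDerivAt_id E).sub_const x).div_const ε).arctan
      have e : 1 / (1 + ((id E - x) / ε) ^ 2) * (1 / ε) = ε / ((x - E) ^ 2 + ε ^ 2) := by
        have h3 : (x - E) ^ 2 + ε ^ 2 ≠ 0 := by positivity
        have h4 : 1 + ((E - x) / ε) ^ 2 = ((x - E) ^ 2 + ε ^ 2) / ε ^ 2 := by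
          field_simp
          ring
        rw [id, h4]
        field_simp
      rw [e] at h
      exact h
    · exact hcont.intervalIntegrable _ _
  · exact (hcont.integrableOn_Icc)
  · exact Filter.Eventually.of_forall fun E => by positivity

/-- pointwise bound -/
lemma pointwise {M : Matrix ι ι ℂ} (hM : M.IsHermitian) (a b η ε : ℝ) (hη : 0 < η) (hε : 0 < ε) :
    ENNReal.ofReal (2 * Real.arctan (η / ε)) * ENNReal.ofReal
      (opTr (cfc (Set.indicator (Set.Icc a b) (fun _ => (1 : ℝ)))
        (Matrix.toEuclideanCLM (𝕜 := ℂ) M))) ≤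
    ∫⁻ E in Set.Icc (a - η) (b + η), ∑ j, ENNReal.ofReal (res M ⟨E, ε⟩ j j).im := by
  have h1 : ∀ E : ℝ, ∑ j, ENNReal.ofReal (res M ⟨E, ε⟩ j j).im =
      ∑ k, ENNReal.ofReal (ε / ((hM.eigenvalues k - E) ^ 2 + ε ^ 2)) := by
    intro E
    rw [← ENNReal.ofReal_sum_of_nonneg, ← ENNReal.ofReal_sum_of_nonneg, trace_res hM]
    · exact hε
    · intros; positivity
    · exact fun j _ => (res_im_pos hM (z := ⟨E, ε⟩) hε j).le
  simp_rw [h1]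
  rw [opTr_cfc hM, ENNReal.ofReal_sum_of_nonneg
    (fun k _ => Set.indicator_nonneg (fun _ _ => zero_le_one) _), Finset.mul_sum,
    lintegral_finsetSum]
  · refine Finset.sum_le_sum fun k _ => ?_
    by_cases hk : hM.eigenvalues k ∈ Set.Icc a b
    · rw [Set.indicator_of_mem hk, ENNReal.ofReal_one, mul_one,
        ← lintegral_window (hM.eigenvalues k) η ε hη hε]
      refine lintegral_mono_set (Set.Icc_subset_Icc ?_ ?_)
      · linarith [hk.1]
      · linarith [hk.2]
    · rw [Set.indicator_of_notMem hk]; simp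
  · intro k _
    fun_prop

lemma isHermitian_add {A : Matrix ι ι ℂ} (hA : A.IsHermitian) (ω : ι → ℝ) :
    (A + Matrix.diagonal (fun x => (ω x : ℂ))).IsHermitian := by
  refine hA.add ?_
  rw [Matrix.isHermitian_diagonal_iff]
  intro i
  simp [isSelfAdjoint_iff]

lemma continuous_res {A : Matrix ι ι ℂ} (hA : A.IsHermitian) {ε : ℝ} (hε : 0 < ε) (j : ι) :
    Continuous fun p : (ι → ℝ) × ℝ =>
      (res (A + Matrix.diagonal (fun x => (p.1 x : ℂ))) ⟨p.2, ε⟩ j j).im := by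
  have hz : Continuous fun p : (ι → ℝ) × ℝ => (⟨p.2, ε⟩ : ℂ) := by
    have : (fun p : (ι → ℝ) × ℝ => (⟨p.2, ε⟩ : ℂ)) = fun p => (p.2 : ℂ) + ε * Complex.I := by
      funext p
      apply Complex.ext <;> simp
    rw [this]; fun_prop
  have hB : Continuous fun p : (ι → ℝ) × ℝ => (A + Matrix.diagonal (fun x => (p.1 x : ℂ)))
      - (⟨p.2, ε⟩ : ℂ) • (1 : Matrix ι ι ℂ) := by
    refine (continuous_const.add (Continuous.matrix_diagonal ?_)).sub (hz.smul continuous_const)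
    fun_prop
  refine Complex.continuous_im.comp (Continuous.matrix_elem ?_ j j)
  simp only [res, Matrix.inv_def, Ring.inverse_eq_inv']
  refine Continuous.smul (Continuous.inv₀ hB.matrix_det fun p => ?_) hB.matrix_adjugate
  have := shift_mul_res (isHermitian_add hA p.1) (z := ⟨p.2, ε⟩) hε
  exact (Matrix.isUnit_det_of_right_inverse this).ne_zero

lemma measurable_res {A : Matrix ι ι ℂ} (hA : A.IsHermitian) {z : ℂ} (hz : 0 < z.im) (j : ι) :
    Measurable fun ω : ι → ℝ => ENNReal.ofReal
      (res (A + Matrix.diagonal (fun x => (ω x : ℂ))) z j j).im := by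
  have := (continuous_res hA hz j).comp (Continuous.prodMk continuous_id
    (continuous_const (y := z.re)) : Continuous fun ω : ι → ℝ => (ω, z.re))
  exact this.measurable.ennreal_ofReal

lemma spectral_averaging {A : Matrix ι ι ℂ} (hA : A.IsHermitian) {z : ℂ} (hz : 0 < z.im)
    (μ : Measure ℝ) [IsProbabilityMeasure μ] (R : ℝ)
    (hμ : μ ≤ ENNReal.ofReal R • (volume : Measure ℝ)) (j : ι) :
    ∫⁻ ω : ι → ℝ, ENNReal.ofReal
      (res (A + Matrix.diagonal (fun x => (ω x : ℂ))) z j j).im ∂(Measure.pi fun _ => μ) ≤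
    ENNReal.ofReal R * ENNReal.ofReal Real.pi := by
  have hm := measurable_res hA hz j
  rw [lintegral_eq_lmarginal_univ (fun _ => (0 : ℝ)), lmarginal_erase' _ hm (Finset.mem_univ j)]
  have hb : (fun x : ι → ℝ => ∫⁻ t : ℝ, ENNReal.ofReal (res (A + Matrix.diagonal
      (fun i => ((Function.update x j t) i : ℂ))) z j j).im ∂μ) ≤
      fun _ => ENNReal.ofReal R * ENNReal.ofReal Real.pi := by
    intro x
    have hM0 := isHermitian_add hA (Function.update x j 0)
    set M := A + Matrix.diagonal (fun i => ((Function.update x j 0) i : ℂ)) with hM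
    have key : ∀ t : ℝ, (res (A + Matrix.diagonal
      (fun i => ((Function.update x j t) i : ℂ))) z j j).im = (-((res M z j j)⁻¹).im) /
      ((t - (-((res M z j j)⁻¹).re)) ^ 2 + (-((res M z j j)⁻¹).im) ^ 2) := by
      intro t
      refine res_rank_one_im hM0 (isHermitian_add hA _) hz j t ?_
      rw [hM, add_assoc]
      congr 1
      ext k l
      by_cases hkl : k = l
      · subst hkl
        by_cases hk : k = j
        · subst hk; simp
        · simp [hk, Matrix.single_apply, Ne.symm hk]
      · have : ¬ (j = k ∧ j = l) := fun h => hkl (h.1.symm.trans h.2)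
        simp [hkl, Matrix.single_apply, this]
    simp only [key]
    refine (lintegral_mono' hμ le_rfl).trans ?_
    rw [lintegral_smul_measure, lintegral_poisson _ _ (neg_inv_im_pos (res_im_pos hM0 hz j))]
    exact le_rfl
  refine (lmarginal_mono hb _).trans ?_
  simp [lmarginal]

lemma density_le (ρ : ℝ → ℝ) (R : ℝ) (hρR : ∀ ω, ρ ω ≤ R) :
    volume.withDensity (fun ω => ENNReal.ofReal (ρ ω)) ≤
      ENNReal.ofReal R • (volume : Measure ℝ) := by
  rw [← withDensity_const]
  exact withDensity_mono (Filter.Eventually.of_forall fun ω => ENNReal.ofReal_le_ofReal (hρR ω))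

lemma wegner_eta {A : Matrix ι ι ℂ} (hA : A.IsHermitian)
    (μ : Measure ℝ) [IsProbabilityMeasure μ] (R : ℝ)
    (hμ : μ ≤ ENNReal.ofReal R • (volume : Measure ℝ)) (a b η : ℝ) (hη : 0 < η) :
    ENNReal.ofReal (2 * Real.arctan η⁻¹) * ∫⁻ ω : ι → ℝ, ENNReal.ofReal
      (opTr (cfc (Set.indicator (Set.Icc a b) (fun _ => (1 : ℝ)))
        (Matrix.toEuclideanCLM (𝕜 := ℂ) (A + Matrix.diagonal (fun x => (ω x : ℂ))))))
        ∂(Measure.pi fun _ => μ) ≤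
    (Fintype.card ι * (ENNReal.ofReal R * ENNReal.ofReal Real.pi)) *
      ENNReal.ofReal (b + η - (a - η)) := by
  have hε : 0 < η ^ 2 := by positivity
  have he : η⁻¹ = η / η ^ 2 := by field_simp
  rw [he]
  have hmeas : ∀ j, Measurable fun p : (ι → ℝ) × ℝ => ENNReal.ofReal
      (res (A + Matrix.diagonal (fun x => (p.1 x : ℂ))) ⟨p.2, η ^ 2⟩ j j).im :=
    fun j => (continuous_res hA hε j).measurable.ennreal_ofReal
  refine (lintegral_const_mul_le _ _).trans ?_
  refine (lintegral_mono fun ω => pointwise (isHermitian_add hA ω) a b η (η ^ 2) hη hε).trans ?_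
  rw [lintegral_lintegral_swap]
  · have : ∀ E : ℝ, ∫⁻ ω : ι → ℝ, ∑ j, ENNReal.ofReal
      (res (A + Matrix.diagonal (fun x => (ω x : ℂ))) ⟨E, η ^ 2⟩ j j).im
        ∂(Measure.pi fun _ => μ) ≤
        Fintype.card ι * (ENNReal.ofReal R * ENNReal.ofReal Real.pi) := by
      intro E
      rw [lintegral_finsetSum]
      · refine (Finset.sum_le_sum fun j _ =>
          spectral_averaging hA (z := ⟨E, η ^ 2⟩) hε μ R hμ j).trans ?_
        simp
      · intro j _
        exact measurable_res hA (z := ⟨E, η ^ 2⟩) hε j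
    refine (lintegral_mono this).trans ?_
    rw [lintegral_const, Measure.restrict_apply_univ, Real.volume_Icc]
  · refine Measurable.aemeasurable ?_
    exact Finset.measurable_sum _ fun j _ => hmeas j

lemma negLap_isHermitian (d L : ℕ) : (negLap d L).IsHermitian := by
  ext x y
  have h1 : ∀ i, (x = y + latticeE d L i) ↔ (y = x - latticeE d L i) := fun i => by
    rw [eq_sub_iff_add_eq]; exact eq_comm
  have h2 : ∀ i, (x = y - latticeE d L i) ↔ (y = x + latticeE d L i) := fun i => by
    rw [eq_sub_iff_add_eq]; exact eq_comm
  simp only [Matrix.conjTranspose_apply, negLap, h1, h2, eq_comm (a := y) (b := x)]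
  simp only [star_sub, star_sum, star_add, apply_ite (star : ℂ → ℂ), star_one, star_zero]
  congr 1
  · simp
  · exact Finset.sum_congr rfl fun i _ => add_comm _ _

lemma wegner {A : Matrix ι ι ℂ} (hA : A.IsHermitian)
    (μ : Measure ℝ) [IsProbabilityMeasure μ] (R : ℝ) (hR : 0 ≤ R)
    (hμ : μ ≤ ENNReal.ofReal R • (volume : Measure ℝ)) (a b : ℝ) (hab : a ≤ b) :
    ∫ ω : ι → ℝ,
      opTr (cfc (Set.indicator (Set.Icc a b) (fun _ => (1 : ℝ)))
        (Matrix.toEuclideanCLM (𝕜 := ℂ) (A + Matrix.diagonal (fun x => (ω x : ℂ)))))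
        ∂(Measure.pi fun _ => μ) ≤ R * (b - a) * Fintype.card ι := by
  set f : (ι → ℝ) → ℝ := fun ω => opTr (cfc (Set.indicator (Set.Icc a b) (fun _ => (1 : ℝ)))
        (Matrix.toEuclideanCLM (𝕜 := ℂ) (A + Matrix.diagonal (fun x => (ω x : ℂ))))) with hf
  have hf0 : ∀ ω, 0 ≤ f ω := by
    intro ω
    simp only [hf]
    rw [opTr_cfc (isHermitian_add hA ω)]
    exact Finset.sum_nonneg fun k _ => Set.indicator_nonneg (fun _ _ => zero_le_one) _
  by_cases hi : Integrable f (Measure.pi fun _ => μ)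
  swap
  · rw [integral_undef hi]
    have : 0 ≤ b - a := by linarith
    positivity
  rw [integral_eq_lintegral_of_nonneg_ae (Filter.Eventually.of_forall hf0) hi.1]
  set X := ∫⁻ ω : ι → ℝ, ENNReal.ofReal (f ω) ∂(Measure.pi fun _ => μ) with hX
  have hbound : ∀ η : ℝ, 0 < η → 2 * Real.arctan η⁻¹ * X.toReal ≤
      Fintype.card ι * (R * Real.pi) * (b + η - (a - η)) := by
    intro η hη
    have h : ENNReal.ofReal (2 * Real.arctan η⁻¹) * X ≤ _ := wegner_eta hA μ R hμ a b η hη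
    have h' := ENNReal.toReal_mono (by
      exact ENNReal.mul_ne_top (ENNReal.mul_ne_top (by simp) (by
        exact ENNReal.mul_ne_top (by simp) (by simp))) (by simp)) h
    have ha : 0 ≤ 2 * Real.arctan η⁻¹ := by
      have : 0 < Real.arctan η⁻¹ := Real.arctan_pos.mpr (by positivity)
      positivity
    rw [ENNReal.toReal_mul, ENNReal.toReal_mul, ENNReal.toReal_mul, ENNReal.toReal_mul,
      ENNReal.toReal_ofReal ha, ENNReal.toReal_ofReal hR, ENNReal.toReal_ofReal Real.pi_pos.le,
      ENNReal.toReal_ofReal (by linarith)] at h'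
    simpa using h'
  have t1 : Filter.Tendsto (fun η : ℝ => 2 * Real.arctan η⁻¹ * X.toReal)
      (nhdsWithin 0 (Set.Ioi 0)) (nhds (2 * (Real.pi / 2) * X.toReal)) := by
    refine Filter.Tendsto.mul_const _ (Filter.Tendsto.const_mul _ ?_)
    exact (Real.tendsto_arctan_atTop.mono_right nhdsWithin_le_nhds).comp tendsto_inv_nhdsGT_zero
  have t2 : Filter.Tendsto (fun η : ℝ => Fintype.card ι * (R * Real.pi) * (b + η - (a - η)))
      (nhdsWithin 0 (Set.Ioi 0)) (nhds (Fintype.card ι * (R * Real.pi) * (b + 0 - (a - 0)))) := by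
    refine Filter.Tendsto.mono_left (Continuous.tendsto ?_ 0) nhdsWithin_le_nhds
    fun_prop
  have h := le_of_tendsto_of_tendsto t1 t2 (by
    filter_upwards [self_mem_nhdsWithin] with η hη using hbound η hη)
  refine le_of_mul_le_mul_left ?_ Real.pi_pos
  calc Real.pi * X.toReal = 2 * (Real.pi / 2) * X.toReal := by ring
    _ ≤ _ := h
    _ = _ := by ring

end Wegner

/-- Wegner estimate with constant `1`: for i.i.d. potential with bounded density
`ρ ≤ R`, `E[tr χ_I(H_ω)] ≤ R |I| |Λ|`. -/
theorem stmt9 (d L : ℕ) (hd : 1 ≤ d)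
    (ρ : ℝ → ℝ) (R : ℝ) (μ : Measure ℝ) [IsProbabilityMeasure μ]
    (hμ : μ = MeasureTheory.volume.withDensity (fun ω => ENNReal.ofReal (ρ ω)))
    (hρ0 : ∀ ω, 0 ≤ ρ ω) (hρR : ∀ ω, ρ ω ≤ R)
    (a b : ℝ) (hab : a ≤ b) :
    ∫ ω : Sites d L → ℝ,
        opTr (cfc (Set.indicator (Set.Icc a b) (fun _ => (1 : ℝ))) (finH d L ω))
        ∂(Measure.pi fun _ => μ) ≤
      R * (b - a) * (Fintype.card (Sites d L)) := by
  subst hμ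
  exact Wegner.wegner (Wegner.negLap_isHermitian d L) _ R ((hρ0 0).trans (hρR 0))
    (Wegner.density_le ρ R hρR) a b hab
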